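/- Let A and B be C*-algebras, V a right A-module, and E : B → S_A(V) a completely positive map. Then there exist a Hilbert C*-module M over A and a ℂ-linear map D : B → Lin_A(V,M) such that (i) E(b*b')(v,v') = ⟨D(b)v | D(b')v'⟩ for all b,b' ∈ B and v,v' ∈ V, and (ii) the ℂ-linear span of ⋃_{b∈B} D(b)V is dense in M. Moreover, there exists a *-homomorphism π : B → L_A(M) such that π(b)(D(b')v) = D(bb')v for all b,b' ∈ B and v ∈ V. -/

import Mathlib

/-- An element of a *-ring is positive (in the algebraic sense) if it is a finite sum of
elements of the form `star a * a`; for a C*-algebra this coincides with the usual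
positivity in the C*-algebra, and likewise for the C*-algebra `M_n(A)` of matrices. -/
def AlgPos {A : Type} [NonUnitalNonAssocSemiring A] [Star A] (a : A) : Prop :=
  ∃ (k : ℕ) (f : Fin k → A), a = ∑ i, star (f i) * f i

/-- A ℂ-sesquilinear map `V × V → A`, conjugate-linear in the first argument and
linear in the second. -/
structure IsSesq {V A : Type} [AddCommGroup V] [Module ℂ V] [AddCommGroup A] [Module ℂ A]
    (s : V → V → A) : Prop where
  add_left : ∀ u v w, s (u + v) w = s u w + s v w
  add_right : ∀ u v w, s u (v + w) = s u v + s u w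
  smul_left : ∀ (c : ℂ) (v w : V), s (c • v) w = (starRingEnd ℂ) c • s v w
  smul_right : ∀ (c : ℂ) (v w : V), s v (c • w) = c • s v w

/-- A positive-definite kernel: all the matrices `(K (x i) (x j) (v i) (v j))_{i,j}`
are positive elements of `M_n(A)`. -/
def KernelPosDef {X V A : Type} [AddCommGroup V] [Module ℂ V]
    [NonUnitalNonAssocSemiring A] [Star A]
    (K : X → X → V → V → A) : Prop :=
  ∀ (n : ℕ) (x : Fin n → X) (v : Fin n → V),
    AlgPos (Matrix.of fun i j => K (x i) (x j) (v i) (v j))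

/-- A right module structure (over an algebra `A`) on a complex vector space. -/
structure IsRightModule (A : Type) {V : Type} [NonUnitalRing A] [Module ℂ A]
    [AddCommGroup V] [Module ℂ V] (sm : V → A → V) : Prop where
  add_sm : ∀ v w a, sm (v + w) a = sm v a + sm w a
  sm_add : ∀ v a b, sm v (a + b) = sm v a + sm v b
  sm_mul : ∀ v a b, sm v (a * b) = sm (sm v a) b
  smul_sm : ∀ (c : ℂ) v a, c • sm v a = sm (c • v) a
  sm_smul : ∀ (c : ℂ) v a, c • sm v a = sm v (c • a)

/-- An `A`-sesquilinear map on a right `A`-module `V`. -/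
structure IsASesq {A V : Type} [NonUnitalRing A] [Module ℂ A] [StarRing A]
    [AddCommGroup V] [Module ℂ V] (sm : V → A → V) (s : V → V → A) : Prop where
  sesq : IsSesq s
  sm_left : ∀ v v' a, s (sm v a) v' = star a * s v v'
  sm_right : ∀ v v' a, s v (sm v' a) = s v v' * a

variable (A : Type) [NonUnitalCStarAlgebra A] [PartialOrder A] [StarOrderedRing A]

/-- A bundled Hilbert C*-module over the C*-algebra `A`: a right `A`-module with an
`A`-valued inner product, complete in the norm `m ↦ ‖⟨m|m⟩‖^(1/2)` (completeness is
expressed via Cauchy sequences, with `‖⟨d|d⟩‖ < ε` equivalent to `‖⟨d|d⟩‖^(1/2) < ε^(1/2)`). -/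
structure HilbertCStarModule : Type 1 where
  M : Type
  [grp : AddCommGroup M]
  [modC : Module ℂ M]
  sm : M → A → M
  rightModule : IsRightModule A sm
  inner : M → M → A
  inner_nonneg : ∀ m, 0 ≤ inner m m
  inner_definite : ∀ m, inner m m = 0 → m = 0
  inner_add_right : ∀ m m' m'', inner m (m' + m'') = inner m m' + inner m m''
  inner_smul_right : ∀ (c : ℂ) m m', inner m (c • m') = c • inner m m'
  inner_sm_right : ∀ m m' a, inner m (sm m' a) = inner m m' * a
  inner_conj : ∀ m m', inner m m' = star (inner m' m)
  complete : ∀ u : ℕ → M,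
    (∀ ε : ℝ, 0 < ε → ∃ N, ∀ j ≥ N, ∀ k ≥ N, ‖inner (u j - u k) (u j - u k)‖ < ε) →
    ∃ m, ∀ ε : ℝ, 0 < ε → ∃ N, ∀ k ≥ N, ‖inner (u k - m) (u k - m)‖ < ε

attribute [instance] HilbertCStarModule.grp HilbertCStarModule.modC

variable {A}

/-- Density of a subset of a Hilbert C*-module with respect to the norm
`m ↦ ‖⟨m|m⟩‖^(1/2)`. -/
def DenseIn (H : HilbertCStarModule A) (S : Set H.M) : Prop :=
  ∀ m : H.M, ∀ ε : ℝ, 0 < ε → ∃ w ∈ S, ‖H.inner (m - w) (m - w)‖ < ε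

/-- `f : V → M` is ℂ-linear and `A`-linear, i.e. `f ∈ Lin_A(V,M)`. -/
structure IsLinAMap {V M : Type} [AddCommGroup V] [Module ℂ V] [AddCommGroup M] [Module ℂ M]
    (smV : V → A → V) (smM : M → A → M) (f : V → M) : Prop where
  map_add : ∀ v w, f (v + w) = f v + f w
  map_smul : ∀ (c : ℂ) v, f (c • v) = c • f v
  map_sm : ∀ v a, f (smV v a) = smM (f v) a

/-- Complete positivity of a ℂ-linear map `E : B → S_A(V)`: for every positive matrix
`(b_ij) ∈ M_n(B)` and all `v_1,…,v_n ∈ V`, the matrix `(E(b_ij)(v_i,v_j))_{i,j}` is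
positive in `M_n(A)`. -/
def CompPos {B V A : Type} [NonUnitalRing B] [StarRing B]
    [AddCommGroup V] [Module ℂ V] [NonUnitalRing A] [StarRing A]
    (E : B → V → V → A) : Prop :=
  ∀ (n : ℕ) (b : Matrix (Fin n) (Fin n) B), AlgPos b →
    ∀ v : Fin n → V, AlgPos (Matrix.of fun i j => E (b i j) (v i) (v j))

/-- ℂ-linearity of `E : B → S(V;A)`. -/
structure IsLinearSesqValued {B V A : Type} [AddCommGroup B] [Module ℂ B]
    [AddCommGroup V] [Module ℂ V] [AddCommGroup A] [Module ℂ A]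
    (E : B → V → V → A) : Prop where
  map_add : ∀ b b' v v', E (b + b') v v' = E b v v' + E b' v v'
  map_smul : ∀ (c : ℂ) b v v', E (c • b) v v' = c • E b v v'

/-- `π b` is adjointable with adjoint `π (star b)`, `π` is ℂ-linear and multiplicative;
this says precisely that `π : B → L_A(M)` is a *-homomorphism into the adjointable
operators on `M`. -/
structure IsStarHomIntoAdjointables {B : Type} [NonUnitalRing B] [Module ℂ B] [StarRing B]
    (H : HilbertCStarModule A) (π : B → H.M → H.M) : Prop where
  adjoint : ∀ b m m', H.inner (π b m) m' = H.inner m (π (star b) m')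
  map_add : ∀ b b' m, π (b + b') m = π b m + π b' m
  map_smul : ∀ (c : ℂ) b m, π (c • b) m = c • π b m
  map_mul : ∀ b b' m, π (b * b') m = π b (π b' m)

open UniformSpace

theorem AlgPos.sum_sum_nonneg {n : ℕ} {m : Matrix (Fin n) (Fin n) A} (h : AlgPos m) :
    0 ≤ ∑ i, ∑ j, m i j := by
  obtain ⟨k, f, rfl⟩ := h
  have key : ∑ i, ∑ j, (∑ p, star (f p) * f p) i j =
      ∑ p, ∑ l, star (∑ i, f p l i) * ∑ j, f p l j := by
    simp only [Matrix.sum_apply, Matrix.mul_apply, Matrix.star_apply, star_sum,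
      Finset.sum_mul_sum]
    calc _ = ∑ i, ∑ p, ∑ j, ∑ l, star (f p l i) * f p l j :=
          Finset.sum_congr rfl fun i _ => Finset.sum_comm
      _ = ∑ p, ∑ i, ∑ j, ∑ l, star (f p l i) * f p l j := Finset.sum_comm
      _ = ∑ p, ∑ i, ∑ l, ∑ j, star (f p l i) * f p l j :=
          Finset.sum_congr rfl fun p _ => Finset.sum_congr rfl fun i _ => Finset.sum_comm
      _ = _ := Finset.sum_congr rfl fun p _ => Finset.sum_comm
  rw [key]
  exact Finset.sum_nonneg fun p _ => Finset.sum_nonneg fun l _ => star_mul_self_nonneg _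

/-- Without a unit, `h` plays the role of `‖b‖ • 1 - √(‖b‖ ^ 2 • 1 - star b * b)`: the identity
says `(‖b‖ • 1 - h) ^ 2 = ‖b‖ ^ 2 • 1 - star b * b`. -/
theorem exists_isSelfAdjoint_two_smul_sub_mul_self {B : Type} [NonUnitalCStarAlgebra B] (b : B) :
    ∃ h : B, IsSelfAdjoint h ∧ ((2 * ‖b‖ : ℝ) : ℂ) • h - h * h = star b * b := by
  set r := ‖b‖
  set a := star b * b
  have ha : IsSelfAdjoint a := .star_mul_self b
  let f : ℝ → ℝ := fun x => r - √(r ^ 2 - x)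
  have hf : Continuous f := by fun_prop
  have hf0 : f 0 = 0 := by simp [f, r, Real.sqrt_sq]
  refine ⟨cfcₙ f a, IsSelfAdjoint.cfcₙ, ?_⟩
  rw [Complex.coe_smul, ← cfcₙ_smul (2 * r) f a hf.continuousOn hf0,
    ← cfcₙ_mul f f a hf.continuousOn hf0 hf.continuousOn hf0,
    ← cfcₙ_sub _ _ a (by fun_prop) (by simp [hf0]) (by fun_prop) (by simp [hf0])]
  conv_rhs => rw [← cfcₙ_id ℝ a]
  refine cfcₙ_congr fun x hx => ?_
  have hx' : x ≤ r ^ 2 := by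
    have := NonUnitalIsometricContinuousFunctionalCalculus.norm_quasispectrum_le a hx ha
    rw [CStarRing.norm_star_mul_self, ← sq] at this
    exact (le_abs_self x).trans this
  have := Real.mul_self_sqrt (sub_nonneg.2 hx')
  simp only [f, smul_eq_mul, id]
  linear_combination -this

/-- A complex vector space with a (possibly degenerate) positive `A`-valued inner product and
a compatible right action of `A`. -/
structure SemiInnerModule (A T : Type) [NonUnitalCStarAlgebra A] [PartialOrder A]
    [StarOrderedRing A] [AddCommGroup T] [Module ℂ T] where
  inner : T →ₗ⋆[ℂ] T →ₗ[ℂ] A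
  nonneg : ∀ t, 0 ≤ inner t t
  conj : ∀ s t, inner s t = star (inner t s)
  act : A → T →ₗ[ℂ] T
  inner_act : ∀ a s t, inner s (act a t) = inner s t * a

namespace SemiInnerModule

variable {T : Type} [AddCommGroup T] [Module ℂ T] (P : SemiInnerModule A T)

theorem inner_act_left (a : A) (s t : T) : P.inner (P.act a s) t = star a * P.inner s t := by
  rw [P.conj, P.inner_act, star_mul, ← P.conj]

theorem norm_inner_sq_le_of_lt (s t : T) {μ : ℝ} (hμ : ‖P.inner s s‖ < μ) :
    ‖P.inner s t‖ ^ 2 ≤ μ * ‖P.inner t t‖ := by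
  have hμ0 : 0 < μ := (norm_nonneg _).trans_lt hμ
  set a := P.inner s t with ha
  have h1 : 0 ≤ star a * P.inner s s * a - μ • (star a * a) - μ • (star a * a)
      + μ • μ • P.inner t t := by
    have := P.nonneg (P.act a s - (μ : ℂ) • t)
    have hts : P.inner t s = star a := P.conj t s
    simp only [map_sub, map_smul, LinearMap.map_smulₛₗ, LinearMap.sub_apply, LinearMap.smul_apply,
      P.inner_act, P.inner_act_left, ← ha, hts, Complex.conj_ofReal, smul_sub] at this
    simp only [Complex.coe_smul] at this
    convert this using 1
    abel
  have h2 : star a * P.inner s s * a ≤ μ • (star a * a) := by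
    have hsa : IsSelfAdjoint (P.inner s s) := (P.conj s s).symm
    refine (CStarAlgebra.star_left_conjugate_le_norm_smul hsa).trans ?_
    exact smul_le_smul_of_nonneg_right hμ.le (star_mul_self_nonneg a)
  have h3 : μ • (star a * a) ≤ μ • μ • P.inner t t := by
    rw [← sub_nonneg]
    calc (0 : A) ≤ _ := h1
      _ ≤ μ • (star a * a) - μ • (star a * a) - μ • (star a * a) + μ • μ • P.inner t t := by
        gcongr
      _ = _ := by abel
  rw [smul_le_smul_iff_of_pos_left hμ0] at h3
  have h4 := CStarAlgebra.norm_le_norm_of_nonneg_of_le (star_mul_self_nonneg a) h3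
  rwa [CStarRing.norm_star_mul_self, norm_smul, Real.norm_of_nonneg hμ0.le, ← sq] at h4

theorem norm_inner_sq_le (s t : T) :
    ‖P.inner s t‖ ^ 2 ≤ ‖P.inner s s‖ * ‖P.inner t t‖ := by
  have h : Filter.Tendsto (fun μ : ℝ => μ * ‖P.inner t t‖)
      (nhdsWithin ‖P.inner s s‖ (Set.Ioi ‖P.inner s s‖))
      (nhds (‖P.inner s s‖ * ‖P.inner t t‖)) :=
    ((continuous_id.mul continuous_const).tendsto _).mono_left nhdsWithin_le_nhds
  refine ge_of_tendsto h ?_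
  filter_upwards [self_mem_nhdsWithin] with μ hμ using P.norm_inner_sq_le_of_lt s t hμ

theorem norm_inner_le (s t : T) :
    ‖P.inner s t‖ ≤ √‖P.inner s s‖ * √‖P.inner t t‖ := by
  rw [← Real.sqrt_mul (norm_nonneg _)]
  exact Real.le_sqrt_of_sq_le (P.norm_inner_sq_le s t)

theorem sqrt_norm_inner_add_le (s t : T) :
    √‖P.inner (s + t) (s + t)‖ ≤ √‖P.inner s s‖ + √‖P.inner t t‖ := by
  refine Real.sqrt_le_iff.2 ⟨by positivity, ?_⟩
  have hs := Real.sq_sqrt (norm_nonneg (P.inner s s))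
  have ht := Real.sq_sqrt (norm_nonneg (P.inner t t))
  have hst := P.norm_inner_le s t
  have hts := P.norm_inner_le t s
  have : ‖P.inner (s + t) (s + t)‖ ≤
      ‖P.inner s s‖ + ‖P.inner s t‖ + (‖P.inner t s‖ + ‖P.inner t t‖) := by
    have e : P.inner (s + t) (s + t) =
        (P.inner s s + P.inner s t) + (P.inner t s + P.inner t t) := by
      simp only [map_add, LinearMap.add_apply]
      abel
    rw [e]
    exact (norm_add_le _ _).trans (add_le_add (norm_add_le _ _) (norm_add_le _ _))
  nlinarith

/-- The seminorm `√‖⟨t|t⟩‖`. -/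
noncomputable def seminorm : AddGroupSeminorm T where
  toFun t := √‖P.inner t t‖
  map_zero' := by simp
  add_le' := P.sqrt_norm_inner_add_le
  neg' t := by simp

/-- The underlying space, seminormed by `√‖⟨t|t⟩‖`. -/
def Carrier (_ : SemiInnerModule A T) : Type := T

instance : AddCommGroup P.Carrier := inferInstanceAs (AddCommGroup T)

instance : Module ℂ P.Carrier := inferInstanceAs (Module ℂ T)

noncomputable instance : SeminormedAddCommGroup P.Carrier :=
  AddGroupSeminorm.toSeminormedAddCommGroup (E := P.Carrier) P.seminorm

/-- The inner product, on the seminormed space. -/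
def form : P.Carrier →ₗ⋆[ℂ] P.Carrier →ₗ[ℂ] A := P.inner

theorem norm_def (t : P.Carrier) : ‖t‖ = √‖P.form t t‖ := rfl

theorem norm_sq (t : P.Carrier) : ‖t‖ ^ 2 = ‖P.form t t‖ :=
  Real.sq_sqrt (norm_nonneg _)

noncomputable instance : NormedSpace ℂ P.Carrier where
  norm_smul_le c t := by
    have : P.form (c • t) (c • t) = ((starRingEnd ℂ) c * c) • P.form t t := by
      rw [map_smul, LinearMap.map_smulₛₗ, LinearMap.smul_apply, smul_smul, mul_comm]
    rw [P.norm_def, P.norm_def, this, norm_smul, Real.sqrt_mul (norm_nonneg _), norm_mul,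
      RCLike.norm_conj, Real.sqrt_mul_self (norm_nonneg _)]

/-- The inner product as a continuous sesquilinear map. -/
noncomputable def formL : P.Carrier →L⋆[ℂ] P.Carrier →L[ℂ] A :=
  P.form.mkContinuous₂ 1 fun s t => by
    rw [one_mul]
    exact P.norm_inner_le s t

theorem formL_apply (s t : P.Carrier) : P.formL s t = P.form s t := rfl

theorem norm_fromCompletion_le {F G : Type} [SeminormedAddCommGroup F] [NormedSpace ℂ F]
    [NormedAddCommGroup G] [NormedSpace ℂ G] [CompleteSpace G] (f : F →L[ℂ] G) :
    ‖f.fromCompletion‖ ≤ ‖f‖ := by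
  refine ContinuousLinearMap.opNorm_le_bound _ (norm_nonneg _) fun x => ?_
  induction x using Completion.induction_on with
  | hp => exact isClosed_le (by fun_prop) (by fun_prop)
  | ih x => simpa using f.le_opNorm x

/-- The inner product on the completion. -/
noncomputable def innerC : Completion P.Carrier →L⋆[ℂ] Completion P.Carrier →L[ℂ] A :=
  ContinuousLinearMap.fromCompletion <|
    LinearMap.mkContinuous
      { toFun := fun s => (P.formL s).fromCompletion
        map_add' := fun s t => ContinuousLinearMap.fromCompletion_unique _ _ fun e => by simp
        map_smul' := fun c s => ContinuousLinearMap.fromCompletion_unique _ _ fun e => by simp }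
      ‖P.formL‖ fun s => (norm_fromCompletion_le _).trans (P.formL.le_opNorm s)

@[simp]
theorem innerC_coe (s t : P.Carrier) : P.innerC s t = P.form s t := by
  simp [innerC, formL_apply]

theorem innerC_nonneg (m : Completion P.Carrier) : 0 ≤ P.innerC m m := by
  induction m using Completion.induction_on with
  | hp => exact isClosed_le (by fun_prop) (by fun_prop)
  | ih t =>
    rw [innerC_coe]
    exact P.nonneg t

theorem norm_innerC_self (m : Completion P.Carrier) : ‖P.innerC m m‖ = ‖m‖ ^ 2 := by
  induction m using Completion.induction_on with
  | hp => exact isClosed_eq (by fun_prop) (by fun_prop)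
  | ih t => simpa using (P.norm_sq t).symm

theorem innerC_conj (m m' : Completion P.Carrier) : P.innerC m m' = star (P.innerC m' m) := by
  induction m, m' using Completion.induction_on₂ with
  | hp => exact isClosed_eq (by fun_prop) (by fun_prop)
  | ih s t =>
    rw [innerC_coe, innerC_coe]
    exact P.conj s t

theorem innerC_ext {m m' : Completion P.Carrier} (h : ∀ x, P.innerC x m = P.innerC x m') :
    m = m' := by
  rw [← sub_eq_zero, ← norm_eq_zero, ← sq_eq_zero_iff, ← P.norm_innerC_self, map_sub, h,
    sub_self, norm_zero]

/-- The extension to the completion of an operator that is bounded for the seminorm. -/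
noncomputable def extend (S : P.Carrier →ₗ[ℂ] P.Carrier) (C : ℝ)
    (hS : ∀ t, ‖P.form (S t) (S t)‖ ≤ C ^ 2 * ‖P.form t t‖) :
    Completion P.Carrier →L[ℂ] Completion P.Carrier :=
  ContinuousLinearMap.completion <|
    S.mkContinuous |C| fun t => by
      refine Real.sqrt_le_iff.2 ⟨by positivity, ?_⟩
      rw [mul_pow, sq_abs, P.norm_sq]
      exact hS t

theorem extend_coe (S : P.Carrier →ₗ[ℂ] P.Carrier) (C : ℝ)
    (hS : ∀ t, ‖P.form (S t) (S t)‖ ≤ C ^ 2 * ‖P.form t t‖) (t : P.Carrier) :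
    P.extend S C hS t = S t :=
  ContinuousLinearMap.completion_apply_coe _ _

/-- The action of `A`, on the seminormed space. -/
def carrierAct (a : A) : P.Carrier →ₗ[ℂ] P.Carrier := P.act a

theorem norm_form_carrierAct_le (a : A) (t : P.Carrier) :
    ‖P.form (P.carrierAct a t) (P.carrierAct a t)‖ ≤ ‖a‖ ^ 2 * ‖P.form t t‖ := by
  have h : P.form (P.carrierAct a t) (P.carrierAct a t) = star a * P.form t t * a :=
    (P.inner_act a _ t).trans (congrArg (· * a) (P.inner_act_left a t t))
  rw [h]
  calc _ ≤ ‖star a‖ * ‖P.form t t‖ * ‖a‖ :=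
        (norm_mul_le _ _).trans (mul_le_mul_of_nonneg_right (norm_mul_le _ _) (norm_nonneg _))
    _ = _ := by rw [norm_star]; ring

/-- The right action of `A` on the completion. -/
noncomputable def actC (a : A) : Completion P.Carrier →L[ℂ] Completion P.Carrier :=
  P.extend (P.carrierAct a) ‖a‖ (P.norm_form_carrierAct_le a)

theorem actC_coe (a : A) (t : P.Carrier) : P.actC a t = P.carrierAct a t :=
  P.extend_coe _ _ _ t

theorem innerC_actC (a : A) (m m' : Completion P.Carrier) :
    P.innerC m (P.actC a m') = P.innerC m m' * a := by
  induction m, m' using Completion.induction_on₂ with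
  | hp => exact isClosed_eq (by fun_prop) (by fun_prop)
  | ih s t =>
    rw [actC_coe, innerC_coe, innerC_coe]
    exact P.inner_act a s t

/-- The Hilbert C*-module obtained by completing a semi-inner-product module. -/
noncomputable def toHilbert : HilbertCStarModule A where
  M := Completion P.Carrier
  sm m a := P.actC a m
  rightModule :=
    { add_sm := fun v w a => map_add _ _ _
      sm_add := fun v a b => P.innerC_ext fun x => by simp [innerC_actC, mul_add]
      sm_mul := fun v a b => P.innerC_ext fun x => by simp [innerC_actC, mul_assoc]
      smul_sm := fun c v a => (map_smul _ _ _).symm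
      sm_smul := fun c v a => P.innerC_ext fun x => by simp [innerC_actC, mul_smul_comm] }
  inner m m' := P.innerC m m'
  inner_nonneg := P.innerC_nonneg
  inner_definite m h := by
    rw [← norm_eq_zero, ← sq_eq_zero_iff, ← P.norm_innerC_self, h, norm_zero]
  inner_add_right _ _ _ := map_add _ _ _
  inner_smul_right _ _ _ := map_smul _ _ _
  inner_sm_right m m' a := P.innerC_actC a m m'
  inner_conj := P.innerC_conj
  complete u hu := by
    simp only [P.norm_innerC_self] at hu ⊢
    have hc : CauchySeq u := Metric.cauchySeq_iff.2 fun ε hε => by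
      obtain ⟨N, hN⟩ := hu (ε ^ 2) (by positivity)
      refine ⟨N, fun j hj k hk => ?_⟩
      rw [dist_eq_norm]
      exact lt_of_pow_lt_pow_left₀ 2 hε.le (hN j hj k hk)
    obtain ⟨m, hm⟩ := cauchySeq_tendsto_of_complete hc
    refine ⟨m, fun ε hε => ?_⟩
    obtain ⟨N, hN⟩ := Metric.tendsto_atTop.1 hm (√ε) (Real.sqrt_pos.2 hε)
    refine ⟨N, fun k hk => ?_⟩
    have := hN k hk
    rwa [dist_eq_norm, Real.lt_sqrt (norm_nonneg _)] at this

/-- A bounded *-representation on a semi-inner-product module extends to the completion. -/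
theorem exists_isStarHomIntoAdjointables {B : Type} [NonUnitalNormedRing B] [Module ℂ B]
    [StarRing B] (L : B →ₗ[ℂ] P.Carrier →ₗ[ℂ] P.Carrier)
    (hmul : ∀ b b' t, L (b * b') t = L b (L b' t))
    (hadj : ∀ b s t, P.form (L b s) t = P.form s (L (star b) t))
    (hnorm : ∀ b t, ‖P.form (L b t) (L b t)‖ ≤ ‖b‖ ^ 2 * ‖P.form t t‖) :
    ∃ π : B → Completion P.Carrier → Completion P.Carrier,
      IsStarHomIntoAdjointables P.toHilbert π ∧ ∀ b (t : P.Carrier), π b t = L b t := by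
  let π : B → Completion P.Carrier →L[ℂ] Completion P.Carrier := fun b =>
    P.extend (L b) ‖b‖ (hnorm b)
  have hπ (b : B) (t : P.Carrier) : π b t = L b t := P.extend_coe _ _ _ t
  have adjoint (b : B) (m m' : Completion P.Carrier) :
      P.innerC (π b m) m' = P.innerC m (π (star b) m') := by
    induction m, m' using Completion.induction_on₂ with
    | hp => exact isClosed_eq (by fun_prop) (by fun_prop)
    | ih s t => rw [hπ, hπ, P.innerC_coe, P.innerC_coe, hadj]
  have add (b b' : B) (m : Completion P.Carrier) : π (b + b') m = π b m + π b' m := by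
    induction m using Completion.induction_on with
    | hp => exact isClosed_eq (by fun_prop) (by fun_prop)
    | ih t => rw [hπ, hπ, hπ, ← Completion.coe_add, map_add, LinearMap.add_apply]
  have smul (c : ℂ) (b : B) (m : Completion P.Carrier) : π (c • b) m = c • π b m := by
    induction m using Completion.induction_on with
    | hp => exact isClosed_eq (π (c • b)).continuous ((π b).continuous.const_smul c)
    | ih t => rw [hπ, hπ, ← Completion.coe_smul, map_smul, LinearMap.smul_apply]
  have mul (b b' : B) (m : Completion P.Carrier) : π (b * b') m = π b (π b' m) := by
    induction m using Completion.induction_on with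
    | hp => exact isClosed_eq (π (b * b')).continuous ((π b).continuous.comp (π b').continuous)
    | ih t => rw [hπ, hπ, hπ, hmul]
  exact ⟨fun b => π b, ⟨adjoint, add, smul, mul⟩, hπ⟩

end SemiInnerModule

section TensorModule

open scoped TensorProduct

variable {A B V : Type} [NonUnitalCStarAlgebra A] [NonUnitalCStarAlgebra B] [AddCommGroup V] [Module ℂ V]
  {smV : V → A → V} {E : B → V → V → A}

/-- The sesquilinear form on `B ⊗ V` given by `⟨b ⊗ v | b' ⊗ v'⟩ = E (b* b') (v, v')`. -/
noncomputable def tensorForm (hlin : IsLinearSesqValued E) (hs : ∀ b, IsSesq (E b)) :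
    (B ⊗[ℂ] V) →ₗ⋆[ℂ] (B ⊗[ℂ] V) →ₗ[ℂ] A :=
  TensorProduct.lift <| LinearMap.mk₂'ₛₗ (starRingEnd ℂ) (starRingEnd ℂ)
    (fun b v => TensorProduct.lift <| LinearMap.mk₂ ℂ (fun b' v' => E (star b * b') v v')
      (fun b₁ b₂ v' => by rw [mul_add, hlin.map_add])
      (fun c b' v' => by rw [mul_smul_comm, hlin.map_smul])
      (fun b' v₁ v₂ => (hs _).add_right _ _ _)
      (fun c b' v' => (hs _).smul_right _ _ _))
    (fun b₁ b₂ v => TensorProduct.ext' fun b' v' => by simp [add_mul, hlin.map_add])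
    (fun c b v => TensorProduct.ext' fun b' v' => by simp [hlin.map_smul, smul_mul_assoc])
    (fun b v₁ v₂ => TensorProduct.ext' fun b' v' => by simp [(hs _).add_left])
    (fun c b v => TensorProduct.ext' fun b' v' => by simp [(hs _).smul_left])

@[simp]
theorem tensorForm_tmul (hlin : IsLinearSesqValued E) (hs : ∀ b, IsSesq (E b))
    (b b' : B) (v v' : V) :
    tensorForm hlin hs (b ⊗ₜ v) (b' ⊗ₜ v') = E (star b * b') v v' := by
  simp [tensorForm]

theorem tensorForm_self_nonneg [PartialOrder A] [StarOrderedRing A]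
    (hlin : IsLinearSesqValued E) (hs : ∀ b, IsSesq (E b))
    (hcp : CompPos E) (t : B ⊗[ℂ] V) : 0 ≤ tensorForm hlin hs t t := by
  obtain ⟨n, b, v, rfl⟩ : ∃ (n : ℕ) (b : Fin n → B) (v : Fin n → V),
      t = ∑ i, b i ⊗ₜ[ℂ] v i := by
    obtain ⟨S, rfl⟩ := TensorProduct.exists_finset t
    refine ⟨S.card, fun i => (S.equivFin.symm i).1.1, fun i => (S.equivFin.symm i).1.2, ?_⟩
    rw [Equiv.sum_comp S.equivFin.symm (fun p => p.1.1 ⊗ₜ[ℂ] p.1.2),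
      Finset.sum_coe_sort S fun p => p.1 ⊗ₜ[ℂ] p.2]
  have hpos : AlgPos (Matrix.of fun i j => star (b i) * b j) := by
    rcases n with _ | n
    · exact ⟨0, Fin.elim0, Matrix.ext fun i => i.elim0⟩
    · refine ⟨1, fun _ => Matrix.of fun i j => if i = 0 then b j else 0, ?_⟩
      ext i j
      simp [Matrix.mul_apply, Matrix.star_apply, apply_ite star]
  have := (hcp n _ hpos v).sum_sum_nonneg
  simp only [Matrix.of_apply] at this
  simpa only [map_sum, LinearMap.sum_apply, tensorForm_tmul,
    Finset.sum_comm (f := fun i j => E (star (b i) * b j) (v i) (v j))] using this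

/-- A sesquilinear map with self-adjoint diagonal is Hermitian. -/
theorem eq_star_of_isSelfAdjoint_diag {T : Type} [AddCommGroup T] [Module ℂ T]
    (q : T →ₗ⋆[ℂ] T →ₗ[ℂ] A) (hq : ∀ t, IsSelfAdjoint (q t t)) (s t : T) :
    q s t = star (q t s) := by
  have add (s t : T) : star (q s t) + star (q t s) = q s t + q t s := by
    have := (hq (s + t)).star_eq
    simp only [map_add, LinearMap.add_apply, star_add, (hq _).star_eq] at this
    linear_combination (norm := module) this
  have h1 := add s t
  have h2 := add s (Complex.I • t)
  simp only [map_smul, LinearMap.map_smulₛₗ, LinearMap.smul_apply, star_smul, Complex.conj_I,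
    RCLike.star_def, neg_smul, LinearMap.neg_apply, star_neg] at h2
  have h3 : star (q t s) - star (q s t) = q s t - q t s := by
    refine smul_right_injective A Complex.I_ne_zero ?_
    simp only [smul_sub]
    linear_combination (norm := module) h2
  have h4 : (2 : ℂ) • q s t = (2 : ℂ) • star (q t s) := by
    simp only [two_smul]
    linear_combination (norm := module) -h1 - h3
  exact smul_right_injective A two_ne_zero h4

/-- The action of `B` on `B ⊗ V` by left multiplication. -/
noncomputable def tensorLeftMul : B →ₗ[ℂ] (B ⊗[ℂ] V) →ₗ[ℂ] (B ⊗[ℂ] V) :=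
  LinearMap.rTensorHom V ∘ₗ LinearMap.mul ℂ B

@[simp]
theorem tensorLeftMul_tmul (b b' : B) (v : V) :
    tensorLeftMul b (b' ⊗ₜ v) = (b * b') ⊗ₜ[ℂ] v := by
  simp [tensorLeftMul]

theorem tensorLeftMul_mul (b b' : B) (t : B ⊗[ℂ] V) :
    tensorLeftMul (b * b') t = tensorLeftMul b (tensorLeftMul b' t) := by
  induction t using TensorProduct.induction_on with
  | zero => simp
  | tmul => simp [mul_assoc]
  | add s t hs ht => simp only [map_add, hs, ht]

theorem tensorForm_tensorLeftMul (hlin : IsLinearSesqValued E) (hs : ∀ b, IsSesq (E b)) (b : B)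
    (s t : B ⊗[ℂ] V) :
    tensorForm hlin hs (tensorLeftMul b s) t =
      tensorForm hlin hs s (tensorLeftMul (star b) t) := by
  induction s using TensorProduct.induction_on with
  | zero => simp
  | add s s' h h' => simp only [map_add, LinearMap.add_apply, h, h']
  | tmul b₁ v₁ =>
    induction t using TensorProduct.induction_on with
    | zero => simp
    | add t t' h h' => simp only [map_add, h, h']
    | tmul b₂ v₂ => simp [mul_assoc]

theorem norm_tensorForm_tensorLeftMul_le [PartialOrder A] [StarOrderedRing A]
    (hlin : IsLinearSesqValued E) (hs : ∀ b, IsSesq (E b))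
    (hcp : CompPos E) (b : B) (t : B ⊗[ℂ] V) :
    ‖tensorForm hlin hs (tensorLeftMul b t) (tensorLeftMul b t)‖ ≤
      ‖b‖ ^ 2 * ‖tensorForm hlin hs t t‖ := by
  obtain ⟨h, hh, hb⟩ := exists_isSelfAdjoint_two_smul_sub_mul_self b
  set q := tensorForm hlin hs
  have hLh (x : B ⊗[ℂ] V) : q (tensorLeftMul h t) x = q t (tensorLeftMul h x) := by
    rw [tensorForm_tensorLeftMul, hh.star_eq]
  have key : q (tensorLeftMul b t) (tensorLeftMul b t) ≤ (‖b‖ ^ 2 : ℝ) • q t t := by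
    rw [← sub_nonneg]
    convert tensorForm_self_nonneg hlin hs hcp ((‖b‖ : ℂ) • t - tensorLeftMul h t) using 1
    change _ = q _ _
    rw [tensorForm_tensorLeftMul, ← tensorLeftMul_mul, ← hb, ← Complex.coe_smul]
    simp only [map_sub, map_smul, LinearMap.map_smulₛₗ, LinearMap.sub_apply,
      LinearMap.smul_apply, hLh, tensorLeftMul_mul, Complex.conj_ofReal, Complex.ofReal_pow,
      Complex.ofReal_mul, Complex.ofReal_ofNat]
    module
  have := CStarAlgebra.norm_le_norm_of_nonneg_of_le (tensorForm_self_nonneg hlin hs hcp _) key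
  rwa [norm_smul, Real.norm_of_nonneg (by positivity)] at this

/-- The right action of `a` on `V` as a linear map. -/
def IsRightModule.toLinearMap (hV : IsRightModule A smV) (a : A) : V →ₗ[ℂ] V where
  toFun v := smV v a
  map_add' v w := hV.add_sm v w a
  map_smul' c v := (hV.smul_sm c v a).symm

/-- `B ⊗ V` with the inner product `⟨b ⊗ v | b' ⊗ v'⟩ = E (b* b') (v, v')`. -/
noncomputable def tensorSemiInner [PartialOrder A] [StarOrderedRing A]
    (hV : IsRightModule A smV) (hlin : IsLinearSesqValued E)
    (hsesq : ∀ b, IsASesq smV (E b)) (hcp : CompPos E) : SemiInnerModule A (B ⊗[ℂ] V) where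
  inner := tensorForm hlin fun b => (hsesq b).sesq
  nonneg := tensorForm_self_nonneg hlin _ hcp
  conj := eq_star_of_isSelfAdjoint_diag _ fun t =>
    .of_nonneg (tensorForm_self_nonneg hlin _ hcp t)
  act a := LinearMap.lTensor B (hV.toLinearMap a)
  inner_act a s t := by
    induction s using TensorProduct.induction_on with
    | zero => simp
    | add s s' h h' => simp only [map_add, LinearMap.add_apply, h, h', add_mul]
    | tmul b₁ v₁ =>
      induction t using TensorProduct.induction_on with
      | zero => simp
      | add t t' h h' => simp only [map_add, h, h', add_mul]
      | tmul b₂ v₂ =>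
        rw [LinearMap.lTensor_tmul, tensorForm_tmul, tensorForm_tmul]
        exact (hsesq _).sm_right v₁ v₂ a

end TensorModule

/-- The generalized KSGNS construction (Lemma 4.2 of the paper): a completely positive
map `E : B → S_A(V)` admits a minimal Kolmogorov decomposition `(M,D)` for the kernel
`(b,b') ↦ E(b^* b')`, together with a *-homomorphism `π : B → L_A(M)` satisfying
`π(b)D(b') = D(bb')`. -/
theorem statement3 (B V : Type) [NonUnitalCStarAlgebra B]
    [AddCommGroup V] [Module ℂ V]
    (smV : V → A → V) (hV : IsRightModule A smV)
    (E : B → V → V → A) (hlin : IsLinearSesqValued E)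
    (hsesq : ∀ b, IsASesq smV (E b)) (hcp : CompPos E) :
    ∃ (H : HilbertCStarModule A) (D : B → V → H.M),
      (∀ b, IsLinAMap smV H.sm (D b)) ∧
      (∀ b b' v, D (b + b') v = D b v + D b' v) ∧
      (∀ (c : ℂ) b v, D (c • b) v = c • D b v) ∧
      (∀ b b' v v', E (star b * b') v v' = H.inner (D b v) (D b' v')) ∧
      DenseIn H (Submodule.span ℂ (⋃ b : B, Set.range (D b)) : Submodule ℂ H.M) ∧
      ∃ π : B → H.M → H.M, IsStarHomIntoAdjointables H π ∧
        ∀ b b' v, π b (D b' v) = D (b * b') v := by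
  have hs (b : B) : IsSesq (E b) := (hsesq b).sesq
  let P := tensorSemiInner hV hlin hsesq hcp
  let ι : TensorProduct ℂ B V →ₗ[ℂ] Completion P.Carrier :=
    (Completion.toComplL : P.Carrier →L[ℂ] Completion P.Carrier).toLinearMap
  let D : B → V → Completion P.Carrier := fun b v => ι (TensorProduct.tmul ℂ b v)
  have hD_add (b : B) (v w : V) : D b (v + w) = D b v + D b w :=
    (congrArg ι (TensorProduct.tmul_add b v w)).trans (map_add ι _ _)
  have hD_smul (b : B) (c : ℂ) (v : V) : D b (c • v) = c • D b v :=
    (congrArg ι (TensorProduct.tmul_smul c b v)).trans (map_smul ι _ _)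
  have hD_sm (b : B) (v : V) (a : A) : D b (smV v a) = P.actC a (D b v) :=
    (P.actC_coe a (TensorProduct.tmul ℂ b v)).symm
  have hadd_D (b b' : B) (v : V) : D (b + b') v = D b v + D b' v :=
    (congrArg ι (TensorProduct.add_tmul b b' v)).trans (map_add ι _ _)
  have hsmul_D (c : ℂ) (b : B) (v : V) : D (c • b) v = c • D b v :=
    (congrArg ι (TensorProduct.smul_tmul' c b v).symm).trans (map_smul ι _ _)
  have hinner (b b' : B) (v v' : V) : E (star b * b') v v' = P.innerC (D b v) (D b' v') :=
    ((P.innerC_coe _ _).trans (tensorForm_tmul hlin hs b b' v v')).symm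
  have hspan (t : TensorProduct ℂ B V) :
      ι t ∈ Submodule.span ℂ (⋃ b : B, Set.range (D b)) := by
    induction t using TensorProduct.induction_on with
    | zero => rw [map_zero]; exact zero_mem _
    | tmul b v => exact Submodule.subset_span (Set.mem_iUnion.2 ⟨b, v, rfl⟩)
    | add s t hs ht => rw [map_add]; exact add_mem hs ht
  have hdense (m : Completion P.Carrier) (ε : ℝ) (hε : 0 < ε) :
      ∃ w ∈ Submodule.span ℂ (⋃ b : B, Set.range (D b)), ‖P.innerC (m - w) (m - w)‖ < ε := by
    obtain ⟨t, ht⟩ := Completion.denseRange_coe.exists_dist_lt m (Real.sqrt_pos.2 hε)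
    refine ⟨t, hspan t, ?_⟩
    rwa [dist_eq_norm, Real.lt_sqrt (norm_nonneg _), ← P.norm_innerC_self] at ht
  obtain ⟨π, hπ, hπD⟩ := P.exists_isStarHomIntoAdjointables tensorLeftMul tensorLeftMul_mul
    (tensorForm_tensorLeftMul hlin hs) (norm_tensorForm_tensorLeftMul_le hlin hs hcp)
  exact ⟨P.toHilbert, D, fun b => ⟨hD_add b, hD_smul b, hD_sm b⟩, hadd_D, hsmul_D, hinner,
    hdense, π, hπ, fun b b' v => (hπD b _).trans (congrArg ι (tensorLeftMul_tmul b b' v))⟩
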